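/- arXiv:2306.00524 — 2 statements merged into one kernel-verified Lean document; each statement's English description precedes it below -/
import Mathlib

section
/- Let f be a homeomorphism of a compact metric space X and let D be a self-similar hyperbolic cw-metric for f with cw-expansiveness constant ξ>0 and expansion constant λ>1. If C_(p,q)∈E satisfies D(C_(p,q))≤ξ and D(f⁻¹(C_(p,q)))≠λ·D(C_(p,q)), then D(f(C_(p,q)))=λ·D(C_(p,q)) and, for every integer k≥1 such that λ^{k−1}·D(C_(p,q))≤ξ, one has D(f^k(C_(p,q)))=λ^k·D(C_(p,q)). -/
open Metric Set Filter Topology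

namespace CwDyn

variable {X : Type*} [MetricSpace X]

/-- The ε-stable set of `x`. -/
def Ws (f : X ≃ₜ X) (ε : ℝ) (x : X) : Set X :=
  {y | ∀ n : ℕ, dist ((⇑f)^[n] x) ((⇑f)^[n] y) ≤ ε}

/-- The ε-unstable set of `x`. -/
def Wu (f : X ≃ₜ X) (ε : ℝ) (x : X) : Set X :=
  {y | ∀ n : ℕ, dist ((⇑f.symm)^[n] x) ((⇑f.symm)^[n] y) ≤ ε}

/-- The connected component of `x` in its ε-stable set. -/
def Cs (f : X ≃ₜ X) (ε : ℝ) (x : X) : Set X := connectedComponentIn (Ws f ε x) x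

/-- The connected component of `x` in its ε-unstable set. -/
def Cu (f : X ≃ₜ X) (ε : ℝ) (x : X) : Set X := connectedComponentIn (Wu f ε x) x

/-- `c` is a cw-expansive constant for `f`. -/
def CwExpansiveConst (f : X ≃ₜ X) (c : ℝ) : Prop :=
  0 < c ∧ ∀ x : X, IsTotallyDisconnected (Ws f c x ∩ Wu f c x)

/-- The cw-local-product-structure. -/
def CwLocalProduct (f : X ≃ₜ X) : Prop :=
  ∀ ε : ℝ, 0 < ε → ∃ δ : ℝ, 0 < δ ∧
    ∀ x y : X, dist x y < δ → (Cs f ε x ∩ Cu f ε y).Nonempty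

/-- `f` is cw-hyperbolic: cw-expansive with the cw-local-product-structure. -/
def CwHyperbolic (f : X ≃ₜ X) : Prop :=
  (∃ c : ℝ, CwExpansiveConst f c) ∧ CwLocalProduct f

/-- A subcontinuum: a nonempty compact connected subset. -/
def Subcontinuum (C : Set X) : Prop := IsCompact C ∧ IsConnected C

/-- `D` is a hyperbolic cw-metric for `f`, viewed as a function of triples `(p, q, C)`
with `C` a subcontinuum and `p, q ∈ C`. -/
structure IsHypCwMetric (f : X ≃ₜ X) (D : X → X → Set X → ℝ) : Prop where
  nonneg : ∀ (C : Set X) (p q : X), Subcontinuum C → p ∈ C → q ∈ C → 0 ≤ D p q C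
  eq_zero_iff : ∀ (C : Set X) (p q : X), Subcontinuum C → p ∈ C → q ∈ C →
    (D p q C = 0 ↔ ∃ z : X, C = {z})
  symm : ∀ (C : Set X) (p q : X), Subcontinuum C → p ∈ C → q ∈ C → D p q C = D q p C
  triangle : ∀ (A B : Set X) (a b c : X), Subcontinuum A → Subcontinuum B →
    a ∈ A → b ∈ A → b ∈ B → c ∈ B → D a c (A ∪ B) ≤ D a b A + D b c B
  hyperbolic : ∃ lam : ℝ, lam ∈ Set.Ioo (0 : ℝ) 1 ∧ ∃ ε₀ : ℝ, 0 < ε₀ ∧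
    (∀ (C : Set X) (p q : X), Subcontinuum C → p ∈ C → q ∈ C →
      (∀ n : ℕ, diam ((⇑f)^[n] '' C) ≤ ε₀) →
      ∀ n : ℕ, D ((⇑f)^[n] p) ((⇑f)^[n] q) ((⇑f)^[n] '' C) ≤ 4 * lam ^ n * D p q C) ∧
    (∀ (C : Set X) (p q : X), Subcontinuum C → p ∈ C → q ∈ C →
      (∀ n : ℕ, diam ((⇑f.symm)^[n] '' C) ≤ ε₀) →
      ∀ n : ℕ, D ((⇑f.symm)^[n] p) ((⇑f.symm)^[n] q) ((⇑f.symm)^[n] '' C) ≤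
        4 * lam ^ n * D p q C)
  compat : ∀ δ : ℝ, 0 < δ → ∃ γ : ℝ, 0 < γ ∧
    (∀ (C : Set X) (p q : X), Subcontinuum C → p ∈ C → q ∈ C → diam C < γ → D p q C < δ) ∧
    (∀ (C : Set X) (p q : X), Subcontinuum C → p ∈ C → q ∈ C → D p q C < γ → diam C < δ)

/-- A hyperbolic cw-metric `D` is self-similar with constants `ξ` and `lam`. -/
def SelfSimilarWith (f : X ≃ₜ X) (D : X → X → Set X → ℝ) (ξ lam : ℝ) : Prop :=
  ∀ (C : Set X) (p q : X), Subcontinuum C → p ∈ C → q ∈ C → D p q C ≤ ξ →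
    max (D (f p) (f q) (⇑f '' C)) (D (f.symm p) (f.symm q) (⇑f.symm '' C)) = lam * D p q C

/-- `f` has continuous joint stable/unstable holonomies with respect to `D`
(for the fixed constants `ε` and `δ`); the membership `pstar ∈ Cu f ε p ∩ Cs f ε y`
says exactly that `pstar ∈ π^s_{x,y}(p)`. -/
def ContJointHolonomies (f : X ≃ₜ X) (D : X → X → Set X → ℝ) (ε δ : ℝ) : Prop :=
  ∀ η : ℝ, 0 < η → ∃ γ : ℝ, 0 < γ ∧
    ∀ (x y p q pstar : X) (C C' : Set X),
      dist x y < δ →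
      Subcontinuum C → C ⊆ Cs f ε x → p ∈ C → q ∈ C → D p q C ≤ γ →
      pstar ∈ Cu f ε p ∩ Cs f ε y →
      Subcontinuum C' → C' ⊆ Cu f ε p → p ∈ C' → pstar ∈ C' → D p pstar C' ≤ γ →
      ∃ (Cst Cuu : Set X) (qstar : X),
        Subcontinuum Cst ∧ Cst ⊆ Cs f ε y ∧ pstar ∈ Cst ∧
        Subcontinuum Cuu ∧ Cuu ⊆ Cu f ε q ∧ q ∈ Cuu ∧
        qstar ∈ Cst ∩ Cuu ∧
        D pstar qstar Cst ≤ η ∧ D q qstar Cuu ≤ η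

/-- `f` has pseudo-isometric joint stable/unstable holonomies with respect to `D`. -/
def PseudoIsomJointHolonomies (f : X ≃ₜ X) (D : X → X → Set X → ℝ) (ε δ : ℝ) : Prop :=
  ∀ η : ℝ, 0 < η → ∃ γ : ℝ, 0 < γ ∧
    ∀ (x y p q pstar : X) (C C' : Set X),
      dist x y < δ →
      Subcontinuum C → C ⊆ Cs f ε x → p ∈ C → q ∈ C → D p q C ≤ γ →
      pstar ∈ Cu f ε p ∩ Cs f ε y →
      Subcontinuum C' → C' ⊆ Cu f ε p → p ∈ C' → pstar ∈ C' → D p pstar C' ≤ γ →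
      ∃ (Cst Cuu : Set X) (qstar : X),
        Subcontinuum Cst ∧ Cst ⊆ Cs f ε y ∧ pstar ∈ Cst ∧
        Subcontinuum Cuu ∧ Cuu ⊆ Cu f ε q ∧ q ∈ Cuu ∧
        qstar ∈ Cst ∩ Cuu ∧
        |D pstar qstar Cst / D p q C - 1| ≤ η ∧ |D q qstar Cuu / D p pstar C' - 1| ≤ η

/-- All local stable holonomies of `f` are isometric with respect to `D`. -/
def IsomStableHolonomies (f : X ≃ₜ X) (D : X → X → Set X → ℝ) (ε δ : ℝ) : Prop :=
  ∀ x y : X, dist x y < δ →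
    ∀ (C : Set X) (p q : X), Subcontinuum C → C ⊆ Cs f δ x → p ∈ C → q ∈ C →
      ∃ (Cst : Set X) (pstar qstar : X),
        Subcontinuum Cst ∧ Cst ⊆ Cs f ε y ∧
        pstar ∈ Cu f ε p ∩ Cs f ε y ∧ pstar ∈ Cst ∧
        qstar ∈ Cu f ε q ∩ Cs f ε y ∧ qstar ∈ Cst ∧
        D pstar qstar Cst = D p q C

/-- All local unstable holonomies of `f` are isometric with respect to `D`. -/
def IsomUnstableHolonomies (f : X ≃ₜ X) (D : X → X → Set X → ℝ) (ε δ : ℝ) : Prop :=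
  ∀ x y : X, dist x y < δ →
    ∀ (C : Set X) (p q : X), Subcontinuum C → C ⊆ Cu f δ x → p ∈ C → q ∈ C →
      ∃ (Cst : Set X) (pstar qstar : X),
        Subcontinuum Cst ∧ Cst ⊆ Cu f ε y ∧
        pstar ∈ Cs f ε p ∩ Cu f ε y ∧ pstar ∈ Cst ∧
        qstar ∈ Cs f ε q ∩ Cu f ε y ∧ qstar ∈ Cst ∧
        D pstar qstar Cst = D p q C

/-- The set of periodic points of `g`. -/
def Per (g : X → X) : Set X := {x | ∃ k : ℕ, 1 ≤ k ∧ g^[k] x = x}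

/-- The set of non-wandering points of `g`. -/
def Omega (g : X → X) : Set X :=
  {x | ∀ U ∈ 𝓝 x, ∃ k : ℕ, 1 ≤ k ∧ (g^[k] '' U ∩ U).Nonempty}

/-- Topological transitivity. -/
def TopTransitive (g : X → X) : Prop :=
  ∀ U V : Set X, IsOpen U → IsOpen V → U.Nonempty → V.Nonempty →
    ∃ n : ℕ, (g^[n] '' U ∩ V).Nonempty

/-- There is a finite ε-pseudo-orbit from `x` to `y` (of length at least one). -/
def PseudoOrbit (g : X → X) (ε : ℝ) (x y : X) : Prop :=
  ∃ (m : ℕ) (σ : ℕ → X), 1 ≤ m ∧ σ 0 = x ∧ σ m = y ∧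
    ∀ k < m, dist (g (σ k)) (σ (k + 1)) ≤ ε

/-- `x` is a chain recurrent point of `g`. -/
def ChainRecurrent (g : X → X) (x : X) : Prop := ∀ ε : ℝ, 0 < ε → PseudoOrbit g ε x x

/-- The chain-recurrent class of `x`. -/
def ChainClass (g : X → X) (x : X) : Set X :=
  {y | ChainRecurrent g y ∧ ∀ ε : ℝ, 0 < ε → PseudoOrbit g ε x y ∧ PseudoOrbit g ε y x}

/-- `C` is a chain-recurrent class of `g`. -/
def IsChainClass (g : X → X) (C : Set X) : Prop :=
  ∃ x : X, ChainRecurrent g x ∧ C = ChainClass g x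

/-- The stable set of a set `C`: points whose forward orbit converges to `C`. -/
def Wstab (g : X → X) (C : Set X) : Set X :=
  {x | Tendsto (fun k : ℕ => infDist (g^[k] x) C) atTop (𝓝 0)}

/-- The unstable set of a set `C`: points whose backward orbit converges to `C`. -/
def Wunstab (f : X ≃ₜ X) (C : Set X) : Set X :=
  {x | Tendsto (fun k : ℕ => infDist ((⇑f.symm)^[k] x) C) atTop (𝓝 0)}

/-- The `n`-th iterate of a homeomorphism, for `n : ℤ`. -/
def zIter (f : X ≃ₜ X) (n : ℤ) : X → X :=
  if 0 ≤ n then (⇑f)^[n.toNat] else (⇑f.symm)^[(-n).toNat]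

/-- Kato's property for the constant `m`: any subcontinuum of diameter greater than `c/2`
attains diameter greater than `c` within `m` iterates (forward or backward). -/
def KatoProperty (f : X ≃ₜ X) (c : ℝ) (m : ℕ) : Prop :=
  ∀ C : Set X, Subcontinuum C → c / 2 < diam C →
    ∃ n : ℤ, |n| ≤ (m : ℤ) ∧ c < diam (zIter f n '' C)

/-- The function `ρ(C) = α^{-N(C)}`, where `N(C)` is the least `|n|` with
`diam(fⁿ(C)) > c` (and `ρ(C) = 0` if no such `n` exists, e.g. for singletons). -/
noncomputable def rho (f : X ≃ₜ X) (c α : ℝ) (C : Set X) : ℝ :=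
  sSup {r : ℝ | ∃ n : ℤ, r = α ^ (-|n|) ∧ c < diam (zIter f n '' C)}

/-- The function `P(C_(p,q)) = inf Σ ρ(A_i)` over chains of subcontinua covering `C`
from `p` to `q`. -/
noncomputable def Pfun (f : X ≃ₜ X) (c α : ℝ) (p q : X) (C : Set X) : ℝ :=
  sInf {s : ℝ | ∃ (n : ℕ) (A : ℕ → Set X) (a : ℕ → X),
    1 ≤ n ∧ a 0 = p ∧ a n = q ∧
    (∀ i < n, Subcontinuum (A i) ∧ a i ∈ A i ∧ a (i + 1) ∈ A i) ∧
    C = ⋃ i ∈ Finset.range n, A i ∧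
    s = ∑ i ∈ Finset.range n, rho f c α (A i)}

/-- The function `D'(C_(p,q)) = max_{|i| ≤ n₀ - 1} P(f^i(C_(p,q)))/λ^{|i|}`. -/
noncomputable def Dprime (f : X ≃ₜ X) (c α lam : ℝ) (n₀ : ℕ) (p q : X) (C : Set X) : ℝ :=
  sSup {r : ℝ | ∃ i : ℤ, |i| ≤ (n₀ : ℤ) - 1 ∧
    r = Pfun f c α (zIter f i p) (zIter f i q) (zIter f i '' C) / lam ^ |i|}

theorem Subcontinuum.image {C : Set X} (hC : Subcontinuum C) {g : X → X} (hg : Continuous g) :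
    Subcontinuum (g '' C) :=
  ⟨hC.1.image hg, hC.2.image g hg.continuousOn⟩

theorem SelfSimilarWith.forward_of_backward_ne {f : X ≃ₜ X} {D : X → X → Set X → ℝ} {ξ lam : ℝ}
    (hss : SelfSimilarWith f D ξ lam) {C : Set X} {p q : X} (hC : Subcontinuum C) (hp : p ∈ C)
    (hq : q ∈ C) (hle : D p q C ≤ ξ)
    (hne : D (f.symm p) (f.symm q) (⇑f.symm '' C) ≠ lam * D p q C) :
    D (f p) (f q) (⇑f '' C) = lam * D p q C := by
  rcases max_choice (D (f p) (f q) (⇑f '' C)) (D (f.symm p) (f.symm q) (⇑f.symm '' C)) with h | h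
  · exact h.symm.trans (hss C p q hC hp hq hle)
  · exact absurd (h.symm.trans (hss C p q hC hp hq hle)) hne

theorem IsHypCwMetric.pos_of_backward_ne {f : X ≃ₜ X} {D : X → X → Set X → ℝ} {lam : ℝ}
    (hD : IsHypCwMetric f D) {C : Set X} {p q : X} (hC : Subcontinuum C) (hp : p ∈ C)
    (hq : q ∈ C) (hne : D (f.symm p) (f.symm q) (⇑f.symm '' C) ≠ lam * D p q C) :
    0 < D p q C := by
  refine (hD.nonneg C p q hC hp hq).lt_of_ne fun h => hne ?_
  obtain ⟨z, hz⟩ := (hD.eq_zero_iff C p q hC hp hq).1 h.symm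
  rw [← h, mul_zero]
  refine (hD.eq_zero_iff _ _ _ (hC.image f.symm.continuous) (mem_image_of_mem _ hp)
    (mem_image_of_mem _ hq)).2 ⟨f.symm z, ?_⟩
  rw [hz, image_singleton]

/-- If `D(C_(p,q)) ≤ ξ` and `D(f⁻¹(C_(p,q))) ≠ λ D(C_(p,q))`, then
`D(f(C_(p,q))) = λ D(C_(p,q))` and `D(f^k(C_(p,q))) = λ^k D(C_(p,q))` for every `k ≥ 1`
with `λ^{k-1} D(C_(p,q)) ≤ ξ`. -/
theorem selfSimilar_forward_iterate
    [CompactSpace X]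
    (f : X ≃ₜ X) (D : X → X → Set X → ℝ) (hD : IsHypCwMetric f D)
    (ξ lam : ℝ) (hξ : 0 < ξ) (hlam : 1 < lam) (hss : SelfSimilarWith f D ξ lam)
    (C : Set X) (p q : X) (hC : Subcontinuum C) (hp : p ∈ C) (hq : q ∈ C)
    (hle : D p q C ≤ ξ)
    (hne : D (f.symm p) (f.symm q) (⇑f.symm '' C) ≠ lam * D p q C) :
    D (f p) (f q) (⇑f '' C) = lam * D p q C ∧
    ∀ k : ℕ, 1 ≤ k → lam ^ (k - 1) * D p q C ≤ ξ →
      D ((⇑f)^[k] p) ((⇑f)^[k] q) ((⇑f)^[k] '' C) = lam ^ k * D p q C := by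
  have hpos : 0 < D p q C := hD.pos_of_backward_ne hC hp hq hne
  have hf := hss.forward_of_backward_ne hC hp hq hle hne
  have key : ∀ k : ℕ, lam ^ k * D p q C ≤ ξ →
      D ((⇑f)^[k] p) ((⇑f)^[k] q) ((⇑f)^[k] '' C) = lam ^ k * D p q C ∧
      D ((⇑f)^[k + 1] p) ((⇑f)^[k + 1] q) ((⇑f)^[k + 1] '' C) = lam ^ (k + 1) * D p q C := by
    intro k
    induction k with
    | zero => exact fun _ => ⟨by simp, by simpa using hf⟩
    | succ k ih =>
      intro hk
      have hlt : lam ^ k * D p q C < lam ^ (k + 1 + 1) * D p q C :=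
        mul_lt_mul_of_pos_right (pow_lt_pow_right₀ hlam (by omega)) hpos
      have hk' : lam ^ k * D p q C ≤ lam ^ (k + 1) * D p q C :=
        mul_le_mul_of_nonneg_right (pow_le_pow_right₀ hlam.le (by omega)) hpos.le
      obtain ⟨h₀, h₁⟩ := ih (hk'.trans hk)
      refine ⟨h₁, ?_⟩
      have hback : ∀ x, f.symm ((⇑f)^[k + 1] x) = (⇑f)^[k] x := fun x => by
        rw [Function.iterate_succ_apply', f.symm_apply_apply]
      have himage : ⇑f.symm '' ((⇑f)^[k + 1] '' C) = (⇑f)^[k] '' C := by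
        simp only [image_image, hback]
      have hstep := hss.forward_of_backward_ne (hC.image (f.continuous.iterate (k + 1)))
        (mem_image_of_mem _ hp) (mem_image_of_mem _ hq) (h₁.le.trans hk) (by
          rw [hback, hback, himage, h₀, h₁, ← mul_assoc, ← pow_succ']
          exact hlt.ne)
      rw [image_image, h₁, ← mul_assoc, ← pow_succ'] at hstep
      simpa only [Function.iterate_succ_apply'] using hstep
  refine ⟨hf, fun k hk hle' => ?_⟩
  obtain ⟨m, rfl⟩ := Nat.exists_eq_add_of_le' hk
  exact (key m hle').2

end CwDyn
end

section
/- With the construction below: if C is a subcontinuum of X and n≥1 is an integer such that ρ(f^i(C))≤α^{−1} for every integer i with |i|≤n−1, then max{ρ(fⁿ(C)), ρ(f⁻ⁿ(C))} ≥ αⁿ·ρ(C). -/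
open Metric Set Filter Topology

namespace CwDyn

variable {X : Type*} [MetricSpace X]

theorem zIter_eq_zpow (f : X ≃ₜ X) (n : ℤ) :
    zIter f n = ⇑((f.toEquiv : Equiv.Perm X) ^ n) := by
  unfold zIter
  split_ifs with hn
  · lift n to ℕ using hn
    rw [Int.toNat_natCast, zpow_natCast, ← Equiv.Perm.iterate_eq_pow]
    rfl
  · obtain ⟨k, rfl⟩ : ∃ k : ℕ, n = -(k : ℤ) := ⟨(-n).toNat, by omega⟩
    rw [neg_neg, Int.toNat_natCast, zpow_neg, zpow_natCast, ← inv_pow,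
      ← Equiv.Perm.iterate_eq_pow]
    rfl

theorem zIter_image_zIter_image (f : X ≃ₜ X) (a b : ℤ) (C : Set X) :
    zIter f a '' (zIter f b '' C) = zIter f (a + b) '' C := by
  rw [← image_comp, zIter_eq_zpow, zIter_eq_zpow, zIter_eq_zpow, zpow_add, Equiv.Perm.coe_mul]

theorem le_rho {f : X ≃ₜ X} {c α : ℝ} (hα : 1 ≤ α) {C : Set X} {n : ℤ}
    (hn : c < diam (zIter f n '' C)) : α ^ (-|n|) ≤ rho f c α C := by
  refine le_csSup ⟨1, ?_⟩ ⟨n, rfl, hn⟩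
  rintro r ⟨k, rfl, -⟩
  exact zpow_le_one_of_nonpos₀ hα (by simp)

theorem rho_nonneg {f : X ≃ₜ X} {c α : ℝ} (hα : 0 ≤ α) (C : Set X) : 0 ≤ rho f c α C := by
  refine Real.sSup_nonneg ?_
  rintro r ⟨k, rfl, -⟩
  exact zpow_nonneg hα _

/-- If `diam (f^k(C)) > c`, then `ρ(f^i(C)) ≥ α^{-|k - i|}`, since `f^(k - i)` maps `f^i(C)` to `f^k(C)`. -/
theorem le_rho_zIter_image {f : X ≃ₜ X} {c α : ℝ} (hα : 1 ≤ α) {C : Set X} {k : ℤ}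
    (hk : c < diam (zIter f k '' C)) (i : ℤ) :
    α ^ (-|k - i|) ≤ rho f c α (zIter f i '' C) :=
  le_rho hα (by rwa [zIter_image_zIter_image, sub_add_cancel])

/-- The expansion property of `ρ`: if `ρ(f^i(C)) ≤ α⁻¹` for all `|i| ≤ n - 1`, then
`max {ρ(fⁿ(C)), ρ(f⁻ⁿ(C))} ≥ αⁿ ρ(C)`. -/
theorem rho_expansion
    [CompactSpace X]
    (f : X ≃ₜ X) (c : ℝ) (hc : CwExpansiveConst f c)
    (m : ℕ) (hm1 : 1 ≤ m) (hm : KatoProperty f c m)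
    (α : ℝ) (hα : α = (2 : ℝ) ^ ((m : ℝ))⁻¹)
    (C : Set X) (hC : Subcontinuum C) (n : ℕ) (hn : 1 ≤ n)
    (h : ∀ i : ℤ, |i| ≤ (n : ℤ) - 1 → rho f c α (zIter f i '' C) ≤ α⁻¹) :
    α ^ n * rho f c α C ≤
      max (rho f c α (zIter f (n : ℤ) '' C)) (rho f c α (zIter f (-(n : ℤ)) '' C)) := by
  have hα1 : 1 < α := by
    rw [hα]
    exact Real.one_lt_rpow one_lt_two (inv_pos.2 (by exact_mod_cast hm1))
  have hα0 : 0 < α := one_pos.trans hα1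
  rw [mul_comm, ← le_div_iff₀ (pow_pos hα0 n)]
  refine Real.sSup_le ?_ (div_nonneg (le_max_of_le_left (rho_nonneg hα0.le _)) (by positivity))
  rintro r ⟨k, rfl, hk⟩
  have hnk : (n : ℤ) ≤ |k| := by
    by_contra! hlt
    have h1 := (le_rho_zIter_image hα1.le hk k).trans (h k (by omega))
    rw [sub_self, abs_zero, neg_zero, zpow_zero] at h1
    exact h1.not_gt (inv_lt_one_of_one_lt₀ hα1)
  rw [le_div_iff₀ (pow_pos hα0 n), ← zpow_natCast, ← zpow_add₀ hα0.ne']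
  rcases le_total 0 k with hk0 | hk0
  · rw [abs_of_nonneg hk0] at hnk ⊢
    refine le_max_of_le_left (le_trans (le_of_eq ?_) (le_rho_zIter_image hα1.le hk n))
    rw [abs_of_nonneg (by omega)]
    congr 1
    ring
  · rw [abs_of_nonpos hk0] at hnk ⊢
    refine le_max_of_le_right (le_trans (le_of_eq ?_) (le_rho_zIter_image hα1.le hk (-n)))
    rw [abs_of_nonpos (by omega)]
    congr 1
    ring


end CwDyn
end
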